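/- Let n ≥ 3. In the braid group B_n: (1) the centre Z(B_n) is the cyclic subgroup generated by θ_n = Δ_n²; (2) for every 1 ≤ i ≤ n−1 one has σ_iΔ_n = Δ_nσ_{n−i}; (3) θ_n = Δ_n² = (σ_{n−1}σ_{n−2}⋯σ_1)^n = (σ_{n−1}²σ_{n−2}⋯σ_1)^{n−1}. -/

import Mathlib

open scoped BigOperators

/-- Defining relations of the braid group `B_n`: generator `i : Fin (n-1)` stands for `σ_{i+1}`. -/
def braidRels (n : ℕ) : Set (FreeGroup (Fin (n - 1))) :=
  {r | (∃ i j : Fin (n - 1), (i : ℕ) + 2 ≤ (j : ℕ) ∧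
          r = FreeGroup.of i * FreeGroup.of j * (FreeGroup.of j * FreeGroup.of i)⁻¹) ∨
       (∃ i j : Fin (n - 1), (j : ℕ) = (i : ℕ) + 1 ∧
          r = FreeGroup.of i * FreeGroup.of j * FreeGroup.of i *
              (FreeGroup.of j * FreeGroup.of i * FreeGroup.of j)⁻¹)}

/-- The braid group on `n` strands. -/
abbrev BraidGroup (n : ℕ) := PresentedGroup (braidRels n)

/-- The generator `σ_i` of `B_n` (paper indexing `1 ≤ i ≤ n-1`; otherwise `1`). -/
def sig (n i : ℕ) : BraidGroup n :=
  if h : 1 ≤ i ∧ i ≤ n - 1 then PresentedGroup.of ⟨i - 1, by omega⟩ else 1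

/-- The product `σ_{i₁} σ_{i₂} ⋯ σ_{i_r}` attached to a list of (paper) indices. -/
def word (n : ℕ) (l : List ℕ) : BraidGroup n := (l.map (sig n)).prod

/-- The Garside element `Δ_n = (σ_1⋯σ_{n−1})(σ_1⋯σ_{n−2})⋯(σ_1σ_2)σ_1`. -/
def garside (n : ℕ) : BraidGroup n :=
  (((List.range (n - 1)).reverse).map (fun j => word n (List.range' 1 (j + 1)))).prod

namespace BrM

/-- adjacency of generators -/
def adj {N : ℕ} (i j : Fin N) : Prop := (i : ℕ) + 1 = j ∨ (j : ℕ) + 1 = i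

theorem adj_symm {N : ℕ} {i j : Fin N} (h : adj i j) : adj j i := Or.symm h
theorem adj_ne {N : ℕ} {i j : Fin N} (h : adj i j) : i ≠ j := by
  rintro rfl; unfold adj at h; omega
theorem adj_tri {N : ℕ} {i j k : Fin N} (h : adj i j) (h' : adj j k) : ¬ adj i k := by
  unfold adj at *; omega

/-- positive word equivalence -/
inductive BE {N : ℕ} : List (Fin N) → List (Fin N) → Prop
  | refl (l) : BE l l
  | symm {l l'} : BE l l' → BE l' l
  | trans {l l' l''} : BE l l' → BE l' l'' → BE l l''
  | cons (a) {l l'} : BE l l' → BE (a :: l) (a :: l')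
  | comm (a b) (l) : ¬ adj a b → BE (a :: b :: l) (b :: a :: l)
  | braid (a b) (l) : adj a b → BE (a :: b :: a :: l) (b :: a :: b :: l)

theorem BE.length {N : ℕ} {l l' : List (Fin N)} (h : BE l l') : l.length = l'.length := by
  induction h <;> simp_all

theorem BE.append_right {N : ℕ} {l l' : List (Fin N)} (h : BE l l') (r : List (Fin N)) :
    BE (l ++ r) (l' ++ r) := by
  induction h with
  | refl l => exact .refl _
  | symm _ ih => exact .symm ih
  | trans _ _ ih ih' => exact .trans ih ih'
  | cons a _ ih => exact .cons a ih
  | comm a b l h => exact .comm a b _ h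
  | braid a b l h => exact .braid a b _ h

theorem BE.append_left {N : ℕ} {l l' : List (Fin N)} (h : BE l l') (r : List (Fin N)) :
    BE (r ++ l) (r ++ l') := by
  induction r with
  | nil => exact h
  | cons a r ih => exact .cons a ih

/-- the congruence -/
def bcon (N : ℕ) : Con (FreeMonoid (Fin N)) where
  r x y := BE x.toList y.toList
  iseqv := ⟨fun _ => .refl _, .symm, .trans⟩
  mul' {w x y z} h h' := by
    simp only [FreeMonoid.toList_mul]
    exact (h.append_right _).trans (h'.append_left _)

/-- the positive braid monoid -/
abbrev PM (N : ℕ) := (bcon N).Quotient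

/-- class of a word -/
def mk {N : ℕ} (l : List (Fin N)) : PM N := ((FreeMonoid.ofList l : FreeMonoid (Fin N)) : PM N)
/-- generator -/
def g {N : ℕ} (a : Fin N) : PM N := mk [a]

theorem mk_eq {N : ℕ} {l l' : List (Fin N)} : mk l = mk l' ↔ BE l l' := (bcon N).eq
theorem mk_cons {N : ℕ} (a) (l : List (Fin N)) : mk (a :: l) = g a * mk l := rfl
theorem mk_nil {N : ℕ} : mk ([] : List (Fin N)) = 1 := rfl
theorem mk_surj {N : ℕ} (x : PM N) : ∃ l, mk l = x := by
  induction x using Con.induction_on with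
  | H x => exact ⟨x.toList, rfl⟩

/-- length -/
def len {N : ℕ} : PM N →* Multiplicative ℕ :=
  (bcon N).lift (FreeMonoid.lift (fun _ => Multiplicative.ofAdd 1)) (by
    intro x y h
    have h : BE x.toList y.toList := h
    have := h.length
    have key : ∀ z : FreeMonoid (Fin N), FreeMonoid.lift (fun _ => Multiplicative.ofAdd 1) z
      = Multiplicative.ofAdd z.toList.length := by
      intro z
      induction z using FreeMonoid.inductionOn' with
      | one => rfl
      | of_mul a z ih => simp [ih, ofAdd_add, mul_comm]
    change FreeMonoid.lift _ x = FreeMonoid.lift _ y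
    rw [key, key, this])

/-- length -/
def ln {N : ℕ} (x : PM N) : ℕ := (len x).toAdd
theorem ln_mul {N : ℕ} (x y : PM N) : ln (x * y) = ln x + ln y := by simp [ln]
theorem ln_one {N : ℕ} : ln (1 : PM N) = 0 := by simp [ln]
theorem ln_g {N : ℕ} (a : Fin N) : ln (g a) = 1 := rfl
theorem ln_mk {N : ℕ} (l : List (Fin N)) : ln (mk l) = l.length := by
  induction l with
  | nil => simp [mk_nil, ln_one]
  | cons a l ih => simp [mk_cons, ln_mul, ln_g, ih, add_comm]

theorem g_comm {N : ℕ} {a b : Fin N} (h : ¬ adj a b) : g a * g b = g b * g a :=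
  mk_eq.2 (.comm a b [] h)
theorem g_braid {N : ℕ} {a b : Fin N} (h : adj a b) : g a * g b * g a = g b * g a * g b :=
  mk_eq.2 (.braid a b [] h)
theorem g_comm' {N : ℕ} {a b : Fin N} (h : ¬ adj a b) (x) : g a * (g b * x) = g b * (g a * x) := by
  rw [← mul_assoc, g_comm h, mul_assoc]
theorem g_braid' {N : ℕ} {a b : Fin N} (h : adj a b) (x) :
    g a * (g b * (g a * x)) = g b * (g a * (g b * x)) := by
  have := congrArg (· * x) (g_braid h)
  simpa only [mul_assoc] using this

/-- conclusion of Garside's lemma -/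
def Cn {N : ℕ} (a : Fin N) (x : PM N) (b : Fin N) (y : PM N) : Prop :=
  (a = b ∧ x = y) ∨ (a ≠ b ∧ ¬ adj a b ∧ ∃ z, x = g b * z ∧ y = g a * z) ∨
  (adj a b ∧ ∃ z, x = g b * (g a * z) ∧ y = g a * (g b * z))

theorem Cn.symm {N : ℕ} {a b : Fin N} {x y : PM N} (h : Cn a x b y) : Cn b y a x := by
  rcases h with ⟨rfl, rfl⟩ | ⟨h, h', z, rfl, rfl⟩ | ⟨h, z, rfl, rfl⟩
  · exact .inl ⟨rfl, rfl⟩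
  · exact .inr (.inl ⟨h.symm, fun k => h' (adj_symm k), z, rfl, rfl⟩)
  · exact .inr (.inr ⟨adj_symm h, z, rfl, rfl⟩)

theorem Cn.of_eq {N : ℕ} {a : Fin N} {x y : PM N} (h : Cn a x a y) : x = y := by
  rcases h with ⟨_, h⟩ | ⟨h, _⟩ | ⟨h, _⟩
  · exact h
  · exact absurd rfl h
  · exact absurd rfl (adj_ne h)
theorem Cn.of_comm {N : ℕ} {a b : Fin N} {x y : PM N} (h : Cn a x b y) (h1 : a ≠ b)
    (h2 : ¬ adj a b) : ∃ z, x = g b * z ∧ y = g a * z := by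
  rcases h with ⟨h, _⟩ | ⟨_, _, h⟩ | ⟨h, _⟩
  · exact absurd h h1
  · exact h
  · exact absurd h h2
theorem Cn.of_adj {N : ℕ} {a b : Fin N} {x y : PM N} (h : Cn a x b y)
    (h2 : adj a b) : ∃ z, x = g b * (g a * z) ∧ y = g a * (g b * z) := by
  rcases h with ⟨h, _⟩ | ⟨_, h, _⟩ | ⟨_, h⟩
  · exact absurd h (adj_ne h2)
  · exact absurd h2 h
  · exact h

theorem Cn_trans_mixed {N : ℕ} (L : ℕ)
    (IH : ∀ (a b : Fin N) (x y : PM N), ln x < L → g a * x = g b * y → Cn a x b y)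
    (a b c : Fin N) (x y u : PM N) (hx : ln x = L)
    (hac : a ≠ c) (nac : ¬ adj a c) (h1 : ∃ z, x = g c * z ∧ u = g a * z)
    (hcb : adj c b) (h2 : ∃ z, u = g b * (g c * z) ∧ y = g c * (g b * z)) : Cn a x b y := by
  have nca : ¬ adj c a := fun k => nac (adj_symm k)
  obtain ⟨z, rfl, hu⟩ := h1
  obtain ⟨z', hu', rfl⟩ := h2
  have hab : a ≠ b := by rintro rfl; exact nca hcb
  have e1 := hu.symm.trans hu'
  have e1l := congrArg ln e1
  simp only [ln_mul, ln_g] at hx e1l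
  have c1 := IH a b z _ (by omega) e1
  by_cases k : adj a b
  · obtain ⟨w, rfl, hw⟩ := c1.of_adj k
    have hwl := congrArg ln hw
    simp only [ln_mul, ln_g] at hx e1l hwl
    obtain ⟨w', rfl, hw'⟩ := (IH c a _ _ (by omega) hw).of_comm hac.symm nca
    have hwl' := congrArg ln hw'
    simp only [ln_mul, ln_g] at hx e1l hwl hwl'
    obtain ⟨v, rfl, rfl⟩ := (IH b c _ _ (by omega) hw').of_adj (adj_symm hcb)
    refine .inr (.inr ⟨k, g c * (g b * (g a * v)), ?_, ?_⟩)
    · rw [g_comm' nac, ← g_braid' (adj_symm hcb), ← g_braid' k, g_comm' nca]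
    · rw [← g_braid' k, g_comm' nca, g_comm' nac v, g_braid' hcb]
  · obtain ⟨w, rfl, hw⟩ := c1.of_comm hab k
    have hwl := congrArg ln hw
    simp only [ln_mul, ln_g] at hx e1l hwl
    obtain ⟨w', rfl, rfl⟩ := (IH c a _ _ (by omega) hw).of_comm hac.symm nca
    refine .inr (.inl ⟨hab, k, g c * (g b * w'), ?_, ?_⟩)
    · rw [g_braid' hcb]
    · rw [← g_comm' k, g_comm' nca]

theorem Cn_trans {N : ℕ} (L : ℕ)
    (IH : ∀ (a b : Fin N) (x y : PM N), ln x < L → g a * x = g b * y → Cn a x b y)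
    (a b c : Fin N) (x y u : PM N) (hx : ln x = L) (hy : ln y = L)
    (h1 : Cn a x c u) (h2 : Cn c u b y) : Cn a x b y := by
  rcases h1 with ⟨rfl, rfl⟩ | ⟨hac, nac, h1⟩ | ⟨hac, h1⟩
  · exact h2
  · rcases h2 with ⟨rfl, rfl⟩ | ⟨hcb, ncb, h2⟩ | ⟨hcb, h2⟩
    · exact .inr (.inl ⟨hac, nac, h1⟩)
    · obtain ⟨z, rfl, hu⟩ := h1
      obtain ⟨z', hu', rfl⟩ := h2
      simp only [ln_mul, ln_g] at hx
      have nca : ¬ adj c a := fun k => nac (adj_symm k)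
      have c1 := IH a b z z' (by omega) (hu.symm.trans hu')
      rcases c1 with ⟨rfl, rfl⟩ | ⟨hab, nab, w, rfl, rfl⟩ | ⟨hab, w, rfl, rfl⟩
      · exact .inl ⟨rfl, rfl⟩
      · exact .inr (.inl ⟨hab, nab, g c * w, by rw [g_comm' ncb], by rw [g_comm' nca]⟩)
      · refine .inr (.inr ⟨hab, g c * w, ?_, ?_⟩)
        · rw [g_comm' ncb, g_comm' nca]
        · rw [g_comm' nca, g_comm' ncb]
    · exact Cn_trans_mixed L IH a b c x y u hx hac nac h1 hcb h2
  · rcases h2 with ⟨rfl, rfl⟩ | ⟨hcb, ncb, h2⟩ | ⟨hcb, h2⟩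
    · exact .inr (.inr ⟨hac, h1⟩)
    · refine (Cn_trans_mixed L IH b a c y x u hy hcb.symm (fun k => ncb (adj_symm k)) ?_
        (adj_symm hac) ?_).symm
      · obtain ⟨z, h, h'⟩ := h2; exact ⟨z, h', h⟩
      · obtain ⟨z, h, h'⟩ := h1; exact ⟨z, h', h⟩
    · obtain ⟨z, rfl, hu⟩ := h1
      obtain ⟨z', hu', rfl⟩ := h2
      have e1 := hu.symm.trans hu'
      have e1l := congrArg ln e1
      simp only [ln_mul, ln_g] at hx e1l
      have nab := adj_tri hac hcb
      by_cases hab : a = b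
      · subst hab
        have c1 := (IH a a _ _ (by simp only [ln_mul, ln_g]; omega) e1).of_eq
        have c2 := (IH c c _ _ (by omega) c1).of_eq
        subst c2
        exact .inl ⟨rfl, rfl⟩
      · obtain ⟨w, hw, hw'⟩ :=
          (IH a b _ _ (by simp only [ln_mul, ln_g]; omega) e1).of_comm hab nab
        obtain ⟨w1, rfl, rfl⟩ := (IH c b _ _ (by omega) hw).of_adj hcb
        obtain ⟨w2, rfl, h3⟩ := (IH c a _ _ (by omega) hw').of_adj (adj_symm hac)
        simp only [ln_mul, ln_g] at hx e1l
        have h4 := (IH c c _ _ (by simp only [ln_mul, ln_g]; omega) h3).of_eq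
        obtain ⟨v, rfl, rfl⟩ := (IH b a _ _ (by omega) h4).of_comm (Ne.symm hab)
          (fun k => nab (adj_symm k))
        refine .inr (.inl ⟨hab, nab, g c * (g b * (g a * (g c * v))), ?_, ?_⟩)
        · rw [g_comm' nab, g_braid' hac, g_braid' hcb]
        · rw [← g_comm' nab, g_braid' (adj_symm hcb), g_braid' (adj_symm hac), ← g_comm' nab]

theorem Cn_main {N : ℕ} (L : ℕ) : ∀ (a b : Fin N) (x y : PM N), ln x = L →
    g a * x = g b * y → Cn a x b y := by
  induction L using Nat.strong_induction_on with
  | _ L IH =>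
    replace IH : ∀ (a b : Fin N) (x y : PM N), ln x < L → g a * x = g b * y → Cn a x b y :=
      fun a b x y h => IH _ h a b x y rfl
    have key : ∀ l l' : List (Fin N), BE l l' → ∀ a b x y, l.length = L + 1 → l = a :: x →
        l' = b :: y → Cn a (mk x) b (mk y) := by
      intro l l' h
      induction h with
      | refl l =>
        rintro a b x y hl rfl h
        cases h
        exact .inl ⟨rfl, rfl⟩
      | symm h ih =>
        intro a b x y hl h1 h2
        exact (ih b a y x (h.length.trans hl) h2 h1).symm
      | @trans l l' l'' h h' ih ih' =>
        intro a b x y hl h1 h2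
        match l' with
        | [] => have := h.length; simp_all
        | c :: u =>
          have e := h.length
          have e' := h'.length
          refine Cn_trans L IH a b c _ _ (mk u) ?_ ?_ (ih a c x u hl h1 rfl)
            (ih' c b u y (e.symm.trans hl) rfl h2)
          · subst h1; simpa [ln_mk] using hl
          · subst h2; simp [ln_mk] at *; omega
      | cons a h ih =>
        intro a b x y hl h1 h2
        cases h1; cases h2
        exact .inl ⟨rfl, mk_eq.2 h⟩
      | comm a b l h =>
        intro a' b' x y hl h1 h2
        cases h1; cases h2
        by_cases hab : a = b
        · subst hab; exact .inl ⟨rfl, rfl⟩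
        · exact .inr (.inl ⟨hab, h, mk l, rfl, rfl⟩)
      | braid a b l h =>
        intro a' b' x y hl h1 h2
        cases h1; cases h2
        exact .inr (.inr ⟨h, mk l, rfl, rfl⟩)
    intro a b x y hx h
    obtain ⟨x, rfl⟩ := mk_surj x
    obtain ⟨y, rfl⟩ := mk_surj y
    rw [ln_mk] at hx
    exact key _ _ (mk_eq.1 h) a b x y (by simp [hx]) rfl rfl

theorem garside_lemma {N : ℕ} {a b : Fin N} {x y : PM N} (h : g a * x = g b * y) : Cn a x b y :=
  Cn_main _ a b x y rfl h

theorem left_cancel {N : ℕ} {m x y : PM N} (h : m * x = m * y) : x = y := by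
  obtain ⟨l, rfl⟩ := mk_surj m
  induction l with
  | nil => simpa [mk_nil] using h
  | cons a l ih =>
    rw [mk_cons, mul_assoc, mul_assoc] at h
    exact ih (garside_lemma h).of_eq

end BrM
namespace BrM

/-- sequences satisfying braid relations -/
structure IsBr {M : Type*} [Monoid M] (s : ℕ → M) (N : ℕ) : Prop where
  comm : ∀ i j, 1 ≤ i → i + 2 ≤ j → j ≤ N → s i * s j = s j * s i
  braid : ∀ i, 1 ≤ i → i + 1 ≤ N → s i * s (i+1) * s i = s (i+1) * s i * s (i+1)

section
variable {M : Type*} [Monoid M]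

/-- `s 1 ⋯ s k` -/
def up (s : ℕ → M) : ℕ → M
  | 0 => 1
  | k+1 => up s k * s (k+1)
/-- `s k ⋯ s 1` -/
def dn (s : ℕ → M) : ℕ → M
  | 0 => 1
  | k+1 => s (k+1) * dn s k
/-- Garside element on `s 1, …, s k` -/
def DD (s : ℕ → M) : ℕ → M
  | 0 => 1
  | k+1 => up s (k+1) * DD s k

variable {s : ℕ → M} {N : ℕ} (h : IsBr s N)
include h

theorem comm_up (k j : ℕ) (hk : k + 2 ≤ j) (hj : j ≤ N) : Commute (s j) (up s k) := by
  induction k with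
  | zero => exact Commute.one_right _
  | succ k ih => exact (ih (by omega)).mul_right (h.comm (k+1) j (by omega) (by omega) hj).symm

theorem comm_dn (k j : ℕ) (hk : k + 2 ≤ j) (hj : j ≤ N) : Commute (s j) (dn s k) := by
  induction k with
  | zero => exact Commute.one_right _
  | succ k ih =>
    exact Commute.mul_right (h.comm (k+1) j (by omega) (by omega) hj).symm (ih (by omega))

theorem comm_DD (k j : ℕ) (hk : k + 2 ≤ j) (hj : j ≤ N) : Commute (s j) (DD s k) := by
  induction k with
  | zero => exact Commute.one_right _
  | succ k ih => exact (comm_up h (k+1) j hk hj).mul_right (ih (by omega))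

theorem DD_succ' (k : ℕ) (hk : k + 1 ≤ N) : DD s (k+1) = DD s k * dn s (k+1) := by
  induction k with
  | zero => simp [DD, up, dn]
  | succ k ih =>
    have e := (comm_DD h k (k+2) le_rfl hk).eq
    rw [show DD s (k+1+1) = up s (k+1) * s (k+2) * DD s (k+1) from rfl, ih (by omega),
      show dn s (k+1+1) = s (k+2) * dn s (k+1) from rfl]
    calc _ = up s (k+1) * (s (k+2) * DD s k) * dn s (k+1) := by simp only [mul_assoc]
      _ = up s (k+1) * DD s k * (s (k+2) * dn s (k+1)) := by rw [e]; simp only [mul_assoc]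
      _ = _ := by rw [← ih (by omega)]; rfl

theorem s_up (i k : ℕ) (hi : 1 ≤ i) (hik : i + 1 ≤ k) (hk : k ≤ N) :
    s (i+1) * up s k = up s k * s i := by
  induction k, hik using Nat.le_induction with
  | base =>
    obtain ⟨i, rfl⟩ : ∃ j, i = j + 1 := ⟨i - 1, by omega⟩
    have e := (comm_up h i (i+2) le_rfl hk).eq
    have b := h.braid (i+1) (by omega) hk
    simp only [up]
    calc _ = (s (i+2) * up s i) * s (i+1) * s (i+2) := by simp only [mul_assoc]
      _ = up s i * (s (i+2) * s (i+1) * s (i+2)) := by rw [e]; simp only [mul_assoc]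
      _ = _ := by rw [← b]; simp only [mul_assoc]
  | succ k hik ih =>
    have c := h.comm i (k+1) hi (by omega) hk
    rw [show up s (k+1) = up s k * s (k+1) from rfl, ← mul_assoc, ih (by omega), mul_assoc, c,
      mul_assoc]

theorem s_dn (i k : ℕ) (hi : 1 ≤ i) (hik : i + 1 ≤ k) (hk : k ≤ N) :
    s i * dn s k = dn s k * s (i+1) := by
  induction k, hik using Nat.le_induction with
  | base =>
    obtain ⟨i, rfl⟩ : ∃ j, i = j + 1 := ⟨i - 1, by omega⟩
    have e := (comm_dn h i (i+2) le_rfl hk).eq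
    have b := h.braid (i+1) (by omega) hk
    simp only [dn]
    calc _ = (s (i+1) * s (i+2) * s (i+1)) * dn s i := by simp only [mul_assoc]
      _ = s (i+2) * s (i+1) * (s (i+2) * dn s i) := by rw [b]; simp only [mul_assoc]
      _ = _ := by rw [e]; simp only [mul_assoc]
  | succ k hik ih =>
    have c := h.comm i (k+1) hi (by omega) hk
    rw [show dn s (k+1) = s (k+1) * dn s k from rfl, ← mul_assoc, c, mul_assoc, ih (by omega),
      mul_assoc]

theorem s_DD (k : ℕ) (hk : k ≤ N) : ∀ i, 1 ≤ i → i ≤ k → s i * DD s k = DD s k * s (k + 1 - i) := by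
  induction k with
  | zero => intro i; omega
  | succ k ih =>
    intro i hi hik
    obtain rfl | ⟨j, rfl⟩ : i = 1 ∨ ∃ j, i = j + 2 := by
      rcases i with _ | _ | j
      · omega
      · exact .inl rfl
      · exact .inr ⟨j, rfl⟩
    · rcases k with _ | k
      · simp [DD, up]
      · rw [DD_succ' h _ hk, ← mul_assoc, ih (by omega) 1 le_rfl (by omega), mul_assoc,
          show k + 1 + 1 - 1 = k + 1 by omega, s_dn h _ _ (by omega) le_rfl hk,
          show k + 1 + 1 + 1 - 1 = k + 1 + 1 by omega, mul_assoc]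
    · rw [show DD s (k+1) = up s (k+1) * DD s k from rfl, ← mul_assoc,
        s_up h (j+1) (k+1) (by omega) hik hk, mul_assoc, ih (by omega) _ (by omega) (by omega),
        mul_assoc, show k + 1 - (j + 1) = k + 1 + 1 - (j + 2) by omega]

omit h in
theorem up_pred (k : ℕ) (hk : 1 ≤ k) : up s k = up s (k-1) * s k := by
  obtain ⟨k, rfl⟩ : ∃ j, k = j + 1 := ⟨k - 1, by omega⟩
  rfl
omit h in
theorem dn_pred (k : ℕ) (hk : 1 ≤ k) : dn s k = s k * dn s (k-1) := by
  obtain ⟨k, rfl⟩ : ∃ j, k = j + 1 := ⟨k - 1, by omega⟩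
  rfl

theorem dn_DD (k : ℕ) (hk : k ≤ N) : dn s k * DD s k = DD s k * up s k := by
  have H : ∀ j, j ≤ k → ∃ u, dn s j * DD s k = DD s k * u ∧ up s (k - j) * u = up s k := by
    intro j
    induction j with
    | zero => intro _; exact ⟨1, by simp [dn]⟩
    | succ j ih =>
      intro hj
      obtain ⟨u, hu, hu'⟩ := ih (by omega)
      refine ⟨s (k - j) * u, ?_, ?_⟩
      · rw [show dn s (j+1) = s (j+1) * dn s j from rfl, mul_assoc, hu, ← mul_assoc,
          s_DD h k hk (j+1) (by omega) hj, mul_assoc, show k + 1 - (j + 1) = k - j by omega]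
      · rw [← mul_assoc, show k - (j + 1) = k - j - 1 by omega, ← up_pred _ (by omega), hu']
  obtain ⟨u, hu, hu'⟩ := H k le_rfl
  rw [hu, ← hu']
  simp [up]

theorem dn_pow_s (k : ℕ) (hk : k ≤ N) (j : ℕ) (hj : j < k) :
    dn s k ^ j * s k = s (k - j) * dn s k ^ j := by
  induction j with
  | zero => simp
  | succ j ih =>
    rw [pow_succ', mul_assoc, ih (by omega), ← mul_assoc, mul_assoc,
      ← mul_assoc _ (dn s k), s_dn h (k - (j+1)) k (by omega) (by omega) hk,
      show k - (j+1) + 1 = k - j by omega, ← mul_assoc]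

theorem dn_pow (k : ℕ) (hk : k + 1 ≤ N) : dn s (k+1) ^ (k+1) = up s (k+1) * dn s k ^ (k+1) := by
  have H : ∀ j, j ≤ k + 1 → ∃ u, dn s (k+1) ^ j = u * dn s k ^ j ∧
      up s (k + 1 - j) * u = up s (k+1) := by
    intro j
    induction j with
    | zero => intro _; exact ⟨1, by simp⟩
    | succ j ih =>
      intro hj
      obtain ⟨u, hu, hu'⟩ := ih (by omega)
      refine ⟨s (k + 1 - j) * u, ?_, ?_⟩
      · rw [pow_succ]
        nth_rewrite 2 [dn]
        rw [← mul_assoc, dn_pow_s h (k+1) hk j (by omega), hu, pow_succ]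
        simp only [mul_assoc]
      · rw [← mul_assoc, show k + 1 - (j + 1) = k + 1 - j - 1 by omega, ← up_pred _ (by omega), hu']
  obtain ⟨u, hu, hu'⟩ := H (k+1) le_rfl
  rw [hu, ← hu']
  simp [up]

theorem DD_sq (k : ℕ) (hk : k ≤ N) : DD s k ^ 2 = dn s k ^ (k+1) := by
  induction k with
  | zero => simp [DD, dn]
  | succ k ih =>
    rw [pow_succ' _ (k+1), dn_pow h k hk, ← ih (by omega), pow_two (DD s k), ← mul_assoc (up s (k+1)),
      show up s (k+1) * DD s k = DD s (k+1) from rfl, ← mul_assoc, dn_DD h _ hk, mul_assoc,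
      show up s (k+1) * DD s k = DD s (k+1) from rfl, pow_two]

theorem DD_sq' (k : ℕ) (hk : k ≤ N) : DD s k ^ 2 = (s k * dn s k) ^ k := by
  have H : ∀ j, j ≤ k → ∃ u, (s k * dn s k) ^ j = u * dn s k ^ j ∧
      u * dn s (k - j) = dn s k := by
    intro j
    induction j with
    | zero => intro _; exact ⟨1, by simp⟩
    | succ j ih =>
      intro hj
      obtain ⟨u, hu, hu'⟩ := ih (by omega)
      refine ⟨u * s (k - j), ?_, ?_⟩
      · rw [pow_succ, hu, ← mul_assoc, mul_assoc u, dn_pow_s h k hk j (by omega), pow_succ]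
        simp only [mul_assoc]
      · rw [mul_assoc, show k - (j + 1) = k - j - 1 by omega, ← dn_pred _ (by omega), hu']
  obtain ⟨u, hu, hu'⟩ := H k le_rfl
  have : u = dn s k := by simpa [dn] using hu'
  rw [hu, this, DD_sq h k hk, pow_succ']

theorem s_dvd_DD (k : ℕ) (hk : k ≤ N) : ∀ i, 1 ≤ i → i ≤ k → ∃ x, DD s k = s i * x := by
  induction k with
  | zero => intro i; omega
  | succ k ih =>
    intro i hi hik
    obtain rfl | ⟨j, rfl⟩ : i = 1 ∨ ∃ j, i = j + 2 := by
      rcases i with _ | _ | j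
      · omega
      · exact .inl rfl
      · exact .inr ⟨j, rfl⟩
    · have : ∀ k, ∃ x, up s (k+1) = s 1 * x := by
        intro k
        induction k with
        | zero => exact ⟨1, by simp [up]⟩
        | succ k ih => obtain ⟨x, hx⟩ := ih; exact ⟨x * s (k+2), by rw [up, hx, mul_assoc]⟩
      obtain ⟨x, hx⟩ := this k
      exact ⟨x * DD s k, by rw [DD, hx, mul_assoc]⟩
    · obtain ⟨x, hx⟩ := ih (by omega) (j+1) (by omega) (by omega)
      exact ⟨up s (k+1) * x, by
        rw [DD, hx, ← mul_assoc, ← s_up h (j+1) (k+1) (by omega) hik hk, mul_assoc]⟩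

theorem s_comm_DD2 (i : ℕ) (hi : 1 ≤ i) (hN : i ≤ N) : Commute (s i) (DD s N ^ 2) := by
  have e1 := s_DD h N le_rfl i hi hN
  have e2 := s_DD h N le_rfl (N + 1 - i) (by omega) (by omega)
  rw [show N + 1 - (N + 1 - i) = i by omega] at e2
  rw [commute_iff_eq, pow_two, ← mul_assoc, e1, mul_assoc, e2, mul_assoc]

end

theorem map_up {M M' : Type*} [Monoid M] [Monoid M'] (f : M →* M') (s : ℕ → M) (k : ℕ) :
    f (up s k) = up (fun i => f (s i)) k := by
  induction k with
  | zero => simp [up]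
  | succ k ih => simp [up, ih]
theorem map_DD {M M' : Type*} [Monoid M] [Monoid M'] (f : M →* M') (s : ℕ → M) (k : ℕ) :
    f (DD s k) = DD (fun i => f (s i)) k := by
  induction k with
  | zero => simp [DD]
  | succ k ih => simp [DD, ih, map_up]

theorem isBr_sig (n : ℕ) : IsBr (sig n) (n-1) where
  comm i j hi hij hj := by
    rw [sig, sig, dif_pos (by omega), dif_pos (by omega), ← mul_inv_eq_one]
    exact PresentedGroup.one_of_mem (.inl ⟨⟨i-1, by omega⟩, ⟨j-1, by omega⟩, by simp; omega, rfl⟩)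
  braid i hi hij := by
    rw [sig, sig, dif_pos (by omega), dif_pos (by omega), ← mul_inv_eq_one]
    exact PresentedGroup.one_of_mem
      (.inr ⟨⟨i-1, by omega⟩, ⟨i+1-1, by omega⟩, by simp; omega, rfl⟩)

theorem word_up (n k : ℕ) : word n (List.range' 1 k) = up (sig n) k := by
  induction k with
  | zero => simp [word, up]
  | succ k ih => rw [up, ← ih, List.range'_concat]; simp [word, add_comm]
theorem word_dn (n k : ℕ) : word n (List.range' 1 k).reverse = dn (sig n) k := by
  induction k with
  | zero => simp [word, dn]
  | succ k ih => rw [dn, ← ih, List.range'_concat]; simp [word, add_comm]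
theorem garside_DD (n : ℕ) : garside n = DD (sig n) (n-1) := by
  have H : ∀ k, (((List.range k).reverse).map
      (fun j => word n (List.range' 1 (j + 1)))).prod = DD (sig n) k := by
    intro k
    induction k with
    | zero => simp [DD]
    | succ k ih => rw [DD, ← ih, List.range_succ]; simp [word_up]
  exact H _

end BrM
namespace BrM

/-- generators of the positive monoid, 1-indexed -/
def sg (N i : ℕ) : PM N := if h : 1 ≤ i ∧ i ≤ N then g ⟨i - 1, by omega⟩ else 1

theorem sg_pos {N i : ℕ} (h : 1 ≤ i) (h' : i ≤ N) : sg N i = g ⟨i - 1, by omega⟩ :=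
  dif_pos ⟨h, h'⟩

theorem g_sg {N : ℕ} (a : Fin N) : g a = sg N (a + 1) := by
  rw [sg_pos (by omega) (by omega)]; rfl

theorem isBr_sg (N : ℕ) : IsBr (sg N) N where
  comm i j hi hij hj := by
    rw [sg_pos hi (by omega), sg_pos (by omega) hj]
    exact g_comm (by simp only [adj]; omega)
  braid i hi hij := by
    rw [sg_pos hi (by omega), sg_pos (by omega) hij]
    exact g_braid (by simp only [adj]; omega)

theorem lc_comm {N i j : ℕ} {x y : PM N} (hi : 1 ≤ i) (hi' : i ≤ N) (hj : 1 ≤ j) (hj' : j ≤ N)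
    (hij : i + 2 ≤ j ∨ j + 2 ≤ i) (h : sg N i * x = sg N j * y) :
    ∃ z, x = sg N j * z ∧ y = sg N i * z := by
  rw [sg_pos hi hi', sg_pos hj hj'] at *
  exact (garside_lemma h).of_comm (by simp only [ne_eq, Fin.mk.injEq]; omega)
    (by simp only [adj]; omega)

theorem lc_braid {N i j : ℕ} {x y : PM N} (hi : 1 ≤ i) (hi' : i ≤ N) (hj : 1 ≤ j) (hj' : j ≤ N)
    (hij : i + 1 = j ∨ j + 1 = i) (h : sg N i * x = sg N j * y) :
    ∃ z, x = sg N j * (sg N i * z) ∧ y = sg N i * (sg N j * z) := by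
  rw [sg_pos hi hi', sg_pos hj hj'] at *
  exact (garside_lemma h).of_adj (by simp only [adj]; omega)

theorem up_strip {N : ℕ} (k j : ℕ) (hk : k + 2 ≤ j) (hj : j ≤ N) (x : PM N)
    (h : sg N j ∣ up (sg N) k * x) : sg N j ∣ x := by
  induction k generalizing x with
  | zero => simpa [up] using h
  | succ k ih =>
    rw [up, mul_assoc] at h
    obtain ⟨y, hy⟩ := ih (by omega) _ h
    obtain ⟨z, hz, _⟩ := lc_comm (by omega) (by omega) (by omega) hj (by omega) hy
    exact ⟨z, hz⟩

theorem DD_strip {N : ℕ} (k j : ℕ) (hk : k + 2 ≤ j) (hj : j ≤ N) (x : PM N)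
    (h : sg N j ∣ DD (sg N) k * x) : sg N j ∣ x := by
  induction k with
  | zero => simpa [DD] using h
  | succ k ih =>
    rw [DD, mul_assoc] at h
    exact ih (by omega) (up_strip _ _ hk hj _ h)

theorem dn_dvd {N : ℕ} (k : ℕ) (hk : k + 1 ≤ N) (w : PM N)
    (h : sg N (k+1) ∣ DD (sg N) k * w) : dn (sg N) (k+1) ∣ w := by
  induction k generalizing w with
  | zero => simpa [DD, dn] using h
  | succ k ih =>
    rw [DD, up, mul_assoc, mul_assoc] at h
    obtain ⟨y, hy⟩ := up_strip k (k+2) le_rfl hk _ h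
    obtain ⟨u, hu, _⟩ := lc_braid (by omega) (by omega) (by omega) hk (by omega) hy
    obtain ⟨w1, rfl⟩ := DD_strip k (k+2) le_rfl hk _ ⟨_, hu⟩
    have e := (comm_DD (isBr_sg N) k (k+2) le_rfl hk).eq
    rw [← mul_assoc, ← e, mul_assoc] at hu
    rw [dn]
    exact mul_dvd_mul_left _ (ih (by omega) _ ⟨u, left_cancel hu⟩)

theorem DD_dvd {N : ℕ} (z : PM N) (k : ℕ) (hk : k ≤ N)
    (h : ∀ i, 1 ≤ i → i ≤ k → sg N i ∣ z) : DD (sg N) k ∣ z := by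
  induction k with
  | zero => simp [DD]
  | succ k ih =>
    obtain ⟨w, rfl⟩ := ih (by omega) (fun i hi hik => h i hi (by omega))
    rw [DD_succ' (isBr_sg N) k hk]
    exact mul_dvd_mul_left _ (dn_dvd k hk w (h (k+1) (by omega) le_rfl))

theorem adj_dvd {N i j : ℕ} {m : PM N} (hm : ∀ u, ∃ v, u * m = m * v)
    (hi : 1 ≤ i) (hi' : i ≤ N) (hj : 1 ≤ j) (hj' : j ≤ N)
    (hij : i + 1 = j ∨ j + 1 = i) (h : sg N i ∣ m) : sg N j ∣ m := by
  obtain ⟨x, hx⟩ := h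
  obtain ⟨v, hv⟩ := hm (sg N j * sg N i)
  have : sg N i * (x * v) = sg N j * (sg N i * m) := by
    rw [← mul_assoc, ← hx, ← hv, mul_assoc]
  obtain ⟨z, _, hz⟩ := lc_braid hi hi' hj hj' hij this
  exact ⟨z, left_cancel hz⟩

theorem quasi_dvd {N : ℕ} {m : PM N} (hm : ∀ u, ∃ v, u * m = m * v) (h1 : m ≠ 1) :
    DD (sg N) N ∣ m := by
  have h0 : ∃ i, 1 ≤ i ∧ i ≤ N ∧ sg N i ∣ m := by
    obtain ⟨l, rfl⟩ := mk_surj m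
    cases l with
    | nil => exact absurd rfl h1
    | cons a l =>
      exact ⟨a + 1, by omega, by omega, by rw [mk_cons, ← g_sg]; exact dvd_mul_right _ _⟩
  obtain ⟨i, hi, hi', hd⟩ := h0
  have hup : ∀ k, i + k ≤ N → sg N (i + k) ∣ m := by
    intro k
    induction k with
    | zero => intro _; exact hd
    | succ k ih =>
      intro hk
      exact adj_dvd hm (i := i + k) (by omega) (by omega) (by omega) hk (.inl rfl) (ih (by omega))
  have hdn : ∀ k, k < i → sg N (i - k) ∣ m := by
    intro k
    induction k with
    | zero => intro _; exact hd
    | succ k ih =>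
      intro hk
      exact adj_dvd hm (i := i - k) (by omega) (by omega) (by omega) (by omega) (by omega)
        (ih (by omega))
  refine DD_dvd m N le_rfl fun j hj hj' => ?_
  rcases le_total i j with h | h
  · simpa [show i + (j - i) = j by omega] using hup (j - i) (by omega)
  · simpa [show i - (i - j) = j by omega] using hdn (i - j) (by omega)

theorem PM_ind {N : ℕ} {p : PM N → Prop} (h1 : p 1)
    (h : ∀ i x, 1 ≤ i → i ≤ N → p x → p (sg N i * x)) (x : PM N) : p x := by
  obtain ⟨l, rfl⟩ := mk_surj x
  induction l with
  | nil => exact h1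
  | cons a l ih => rw [mk_cons, g_sg]; exact h _ _ (by omega) (by omega) ih

theorem DD_quasi {N : ℕ} (u : PM N) : ∃ v, v * DD (sg N) N = DD (sg N) N * u := by
  induction u using PM_ind with
  | h1 => exact ⟨1, by simp⟩
  | h i x hi hi' ih =>
    obtain ⟨v, hv⟩ := ih
    have e := s_DD (isBr_sg N) N le_rfl (N + 1 - i) (by omega) (by omega)
    rw [show N + 1 - (N + 1 - i) = i by omega] at e
    exact ⟨sg N (N+1-i) * v, by rw [mul_assoc, hv, ← mul_assoc, e, mul_assoc]⟩

theorem DD2_central {N : ℕ} (u : PM N) : Commute u (DD (sg N) N ^ 2) := by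
  induction u using PM_ind with
  | h1 => exact Commute.one_left _
  | h i x hi hi' ih => exact (s_comm_DD2 (isBr_sg N) i hi hi').mul_left ih

theorem quasi_pow {N : ℕ} (hN : 1 ≤ N) (L : ℕ) : ∀ m : PM N, ln m ≤ L →
    (∀ u, ∃ v, u * m = m * v) → ∃ k, m = DD (sg N) N ^ k := by
  induction L with
  | zero =>
    intro m hL hm
    refine ⟨0, ?_⟩
    obtain ⟨l, rfl⟩ := mk_surj m
    rw [ln_mk] at hL
    have : l = [] := by simpa using hL
    subst this
    rw [pow_zero]; rfl
  | succ L ih =>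
    intro m hL hm
    by_cases h1 : m = 1
    · exact ⟨0, by simpa using h1⟩
    obtain ⟨m', rfl⟩ := quasi_dvd hm h1
    have hD : 1 ≤ ln (DD (sg N) N) := by
      obtain ⟨x, hx⟩ := s_dvd_DD (isBr_sg N) N le_rfl 1 le_rfl hN
      rw [hx, ln_mul, sg_pos le_rfl hN, ln_g]; omega
    rw [ln_mul] at hL
    obtain ⟨k, hk⟩ := ih m' (by omega) (by
      intro u
      obtain ⟨u', hu'⟩ := DD_quasi u
      obtain ⟨v, hv⟩ := hm u'
      refine ⟨v, left_cancel (m := DD (sg N) N) ?_⟩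
      rw [← mul_assoc, ← hu', mul_assoc, hv, mul_assoc])
    exact ⟨k + 1, by rw [hk, pow_succ']⟩

/-- the central submonoid generated by the square of the Garside element -/
def SS (N : ℕ) : Submonoid (PM N) := Submonoid.powers (DD (sg N) N ^ 2)

theorem SS_comm {N : ℕ} (s : SS N) (r : PM N) : (s : PM N) * r = r * s := by
  obtain ⟨_, k, rfl⟩ := s
  exact ((DD2_central r).pow_right k).symm

instance oreSS (N : ℕ) : OreLocalization.OreSet (SS N) where
  ore_right_cancel r₁ r₂ s h := ⟨s, by rw [SS_comm, SS_comm, h]⟩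
  oreNum r _ := r
  oreDenom _ s := s
  ore_eq r s := SS_comm s r

/-- localization -/
abbrev LL (N : ℕ) := OreLocalization (SS N) (PM N)

/-- canonical map -/
def nu (N : ℕ) : PM N →* LL N := OreLocalization.numeratorHom

theorem nu_inj (N : ℕ) : Function.Injective (nu N) := by
  intro x y h
  obtain ⟨u, v, h1, h2⟩ := OreLocalization.oreDiv_eq_iff.1 h
  simp only [OneMemClass.coe_one, mul_one] at h2
  subst h2
  exact (left_cancel h1).symm

theorem sg_div {N i : ℕ} (hi : 1 ≤ i) (hN : i ≤ N) :
    ∃ x, sg N i * x = DD (sg N) N ^ 2 ∧ x * sg N i = DD (sg N) N ^ 2 := by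
  obtain ⟨x, hx⟩ := s_dvd_DD (isBr_sg N) N le_rfl i hi hN
  have e : sg N i * (x * DD (sg N) N) = DD (sg N) N ^ 2 := by rw [← mul_assoc, ← hx, pow_two]
  refine ⟨_, e, left_cancel (m := sg N i) ?_⟩
  rw [← mul_assoc, e]
  exact (DD2_central _).symm

theorem nu_unit {N : ℕ} (a : Fin N) : IsUnit (nu N (g a)) := by
  obtain ⟨x, h1, h2⟩ := sg_div (N := N) (i := a + 1) (by omega) (by omega)
  rw [← g_sg] at h1 h2
  have hu : IsUnit (nu N (DD (sg N) N ^ 2)) :=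
    OreLocalization.numerator_isUnit (⟨_, Submonoid.mem_powers _⟩ : SS N)
  have h1 := congrArg (nu N) h1
  have h2 := congrArg (nu N) h2
  rw [map_mul] at h1 h2
  obtain ⟨c, hc⟩ := hu
  refine ⟨⟨nu N (g a), nu N x * ↑c⁻¹, ?_, ?_⟩, rfl⟩
  · rw [← mul_assoc, h1, ← hc]; simp
  · have : (nu N x * ↑c⁻¹) = ↑c⁻¹ * nu N x := by
      have e := congrArg (nu N) (DD2_central x).eq
      rw [map_mul, map_mul, ← hc] at e
      rw [Units.mul_inv_eq_iff_eq_mul, mul_assoc, e, ← mul_assoc]; simp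
    rw [this, mul_assoc, h2, ← hc]; simp

/-- map of monoid into the braid group -/
def ph (n : ℕ) : PM (n-1) →* BraidGroup n :=
  (bcon (n-1)).lift (FreeMonoid.lift (fun a => PresentedGroup.of a)) (by
    intro x y h
    have h : BE x.toList y.toList := h
    have br := isBr_sig n
    have hof : ∀ a : Fin (n-1), (PresentedGroup.of a : BraidGroup n) = sig n (a + 1) := by
      intro a; rw [sig, dif_pos (by omega)]; rfl
    have key : ∀ l l' : List (Fin (n-1)), BE l l' →
        (l.map (fun a => (PresentedGroup.of a : BraidGroup n))).prod =
        (l'.map (fun a => (PresentedGroup.of a : BraidGroup n))).prod := by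
      intro l l' h
      induction h with
      | refl => rfl
      | symm _ ih => exact ih.symm
      | trans _ _ ih ih' => exact ih.trans ih'
      | cons a _ ih => simp [ih]
      | comm a b l h =>
        simp only [List.map_cons, List.prod_cons, ← mul_assoc]
        congr 1
        unfold adj at h
        rw [hof, hof]
        rcases lt_trichotomy (a : ℕ) b with k | k | k
        · exact br.comm _ _ (by omega) (by omega) (by omega)
        · rw [k]
        · exact (br.comm _ _ (by omega) (by omega) (by omega)).symm
      | braid a b l h =>
        simp only [List.map_cons, List.prod_cons, ← mul_assoc]
        congr 1
        rw [hof, hof]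
        rcases h with h | h
        · rw [← h]; exact br.braid _ (by omega) (by omega)
        · rw [← h]; exact (br.braid _ (by omega) (by omega)).symm
    have := key _ _ h
    change FreeMonoid.lift _ x = FreeMonoid.lift _ y
    rw [FreeMonoid.lift_apply, FreeMonoid.lift_apply]
    exact this)

theorem ph_g (n : ℕ) (a : Fin (n-1)) : ph n (g a) = PresentedGroup.of a := by
  change FreeMonoid.lift (fun a => (PresentedGroup.of a : BraidGroup n)) (FreeMonoid.of a) = _
  simp

theorem ph_sg (n i : ℕ) : ph n (sg (n-1) i) = sig n i := by
  unfold sg sig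
  split_ifs with h
  · exact ph_g _ _
  · exact map_one (ph n)

/-- group map to units of localization -/
noncomputable def ps (n : ℕ) : BraidGroup n →* (LL (n-1))ˣ :=
  PresentedGroup.toGroup (G := (LL (n-1))ˣ) (f := fun a => (nu_unit a).unit) (by
    rintro r (⟨i, j, h, rfl⟩ | ⟨i, j, h, rfl⟩)
    · simp only [map_mul, map_inv, FreeGroup.lift_apply_of]
      rw [mul_inv_eq_one]
      ext
      simp only [Units.val_mul, IsUnit.unit_spec, ← map_mul]
      rw [g_comm (by unfold adj; omega)]
    · simp only [map_mul, map_inv, FreeGroup.lift_apply_of]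
      rw [mul_inv_eq_one]
      ext
      simp only [Units.val_mul, IsUnit.unit_spec, ← map_mul]
      rw [g_braid (by unfold adj; omega)])

theorem ps_ph (n : ℕ) (x : PM (n-1)) : (ps n (ph n x) : LL (n-1)) = nu _ x := by
  obtain ⟨l, rfl⟩ := mk_surj x
  induction l with
  | nil => simp [mk_nil]
  | cons a l ih =>
    rw [mk_cons, map_mul, map_mul, Units.val_mul, ih, map_mul, ph_g]
    congr 1
    rw [ps, PresentedGroup.toGroup.of]
    rfl

theorem ph_inj (n : ℕ) : Function.Injective (ph n) := by
  intro x y h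
  apply nu_inj
  rw [← ps_ph, ← ps_ph, h]

theorem ph_DD (n : ℕ) : ph n (DD (sg (n-1)) (n-1)) = garside n := by
  rw [map_DD, garside_DD]
  simp only [ph_sg]

theorem of_sig (n : ℕ) (a : Fin (n-1)) : (PresentedGroup.of a : BraidGroup n) = sig n (a + 1) := by
  rw [sig, dif_pos (by omega)]; rfl

theorem garside2_central (n : ℕ) : garside n ^ 2 ∈ Subgroup.center (BraidGroup n) := by
  rw [Subgroup.mem_center_iff]
  have : (⊤ : Subgroup (BraidGroup n)) ≤ Subgroup.centralizer {garside n ^ 2} := by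
    rw [← PresentedGroup.closure_range_of, Subgroup.closure_le]
    rintro _ ⟨a, rfl⟩
    rw [SetLike.mem_coe, Subgroup.mem_centralizer_singleton_iff, of_sig, garside_DD]
    exact (s_comm_DD2 (isBr_sig n) (a+1) (by omega) (by omega)).eq
  intro x
  exact Subgroup.mem_centralizer_singleton_iff.1 (this (Subgroup.mem_top x))

theorem exists_pos (n : ℕ) (z : BraidGroup n) : ∃ k m, z * (garside n ^ 2) ^ k = ph n m := by
  have hz : z ∈ Subgroup.closure (Set.range (PresentedGroup.of (rels := braidRels n))) := by
    rw [PresentedGroup.closure_range_of]; trivial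
  induction hz using Subgroup.closure_induction_left with
  | one => exact ⟨0, 1, by simp⟩
  | mul_left x hx y _ ih =>
    obtain ⟨a, rfl⟩ := hx
    obtain ⟨k, m, h⟩ := ih
    exact ⟨k, g a * m, by rw [map_mul, ← h, ph_g, mul_assoc]⟩
  | inv_mul_cancel x hx y _ ih =>
    obtain ⟨a, rfl⟩ := hx
    obtain ⟨k, m, h⟩ := ih
    obtain ⟨x, h1, h2⟩ := sg_div (N := n-1) (i := a + 1) (by omega) (by omega)
    have h1' := congrArg (ph n) h1
    rw [← g_sg, map_mul, ph_g, map_pow, ph_DD] at h1'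
    have hc := Subgroup.mem_center_iff.1 (garside2_central n)
    refine ⟨k + 1, x * m, ?_⟩
    rw [map_mul, ← h, pow_succ, mul_assoc, inv_mul_eq_iff_eq_mul, ← mul_assoc, ← mul_assoc,
      ← mul_assoc, h1', ← hc, mul_assoc, mul_assoc, hc]

theorem center_eq (n : ℕ) (hn : 3 ≤ n) :
    Subgroup.center (BraidGroup n) = Subgroup.zpowers (garside n ^ 2) := by
  apply le_antisymm
  swap
  · rw [Subgroup.zpowers_le]; exact garside2_central n
  intro z hz
  obtain ⟨k, m, h⟩ := exists_pos n z
  have hm : ph n m ∈ Subgroup.center (BraidGroup n) := by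
    rw [← h]; exact mul_mem hz (pow_mem (garside2_central n) k)
  rw [Subgroup.mem_center_iff] at hm
  obtain ⟨j, hj⟩ := quasi_pow (N := n-1) (by omega) _ m le_rfl (fun u => ⟨u, ph_inj n (by
    rw [map_mul, map_mul, hm])⟩)
  rw [hj, map_pow, ph_DD] at h
  rcases Nat.even_or_odd' j with ⟨i, rfl | rfl⟩
  · rw [pow_mul] at h
    rw [eq_mul_inv_of_mul_eq h]
    exact mul_mem (Subgroup.npow_mem_zpowers _ _) (inv_mem (Subgroup.npow_mem_zpowers _ _))
  · exfalso
    have hD : garside n ∈ Subgroup.center (BraidGroup n) := by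
      rw [pow_succ _ (2 * i), pow_mul] at h
      rw [← inv_mul_eq_iff_eq_mul] at h
      rw [← h]
      exact mul_mem (inv_mem (pow_mem (garside2_central n) _))
        (mul_mem hz (pow_mem (garside2_central n) _))
    rw [Subgroup.mem_center_iff] at hD
    have e := s_DD (isBr_sig n) (n-1) le_rfl 1 le_rfl (by omega)
    rw [← garside_DD, hD] at e
    have e := mul_left_cancel e
    rw [← ph_sg, ← ph_sg] at e
    have e := ph_inj n e
    rw [sg_pos le_rfl (by omega), sg_pos (by omega) (by omega)] at e
    have e2 : g (N := n - 1) ⟨1 - 1, by omega⟩ * 1 = g ⟨n - 1 + 1 - 1 - 1, by omega⟩ * 1 := by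
      rw [mul_one, mul_one]; exact e
    rcases garside_lemma e2 with ⟨h, _⟩ | ⟨_, _, z, h, _⟩ | ⟨_, z, h, _⟩
    · simp only [Fin.mk.injEq] at h; omega
    · have := congrArg ln h
      rw [ln_one, ln_mul, ln_g] at this; omega
    · have := congrArg ln h
      rw [ln_one, ln_mul, ln_g] at this; omega

end BrM

/-- for `n ≥ 3`, the centre of the braid group `B_n` is the cyclic subgroup
generated by `θ_n = Δ_n²`; `σ_i Δ_n = Δ_n σ_{n−i}` for every `1 ≤ i ≤ n−1`; and
`θ_n = Δ_n² = (σ_{n−1}σ_{n−2}⋯σ_1)^n = (σ_{n−1}²σ_{n−2}⋯σ_1)^{n−1}`. -/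
theorem statement_0 (n : ℕ) (hn : 3 ≤ n) :
    Subgroup.center (BraidGroup n) = Subgroup.zpowers (garside n ^ 2) ∧
    (∀ i : ℕ, 1 ≤ i → i ≤ n - 1 →
      sig n i * garside n = garside n * sig n (n - i)) ∧
    garside n ^ 2 = word n ((List.range' 1 (n - 1)).reverse) ^ n ∧
    garside n ^ 2 =
      (sig n (n - 1) * word n ((List.range' 1 (n - 1)).reverse)) ^ (n - 1) := by
  rw [BrM.word_dn, BrM.garside_DD]
  have br := BrM.isBr_sig n
  refine ⟨by rw [← BrM.garside_DD]; exact BrM.center_eq n hn, ?_, ?_, ?_⟩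
  · intro i hi hi'
    rw [BrM.s_DD br _ le_rfl i hi hi', show n - 1 + 1 - i = n - i by omega]
  · rw [BrM.DD_sq br _ le_rfl, show n - 1 + 1 = n by omega]
  · exact BrM.DD_sq' br _ le_rfl
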